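/- arXiv:2109.07728 — 2 statements merged into one kernel-verified Lean document; each statement's English description precedes it below -/
import Mathlib

section
/- Let A be an abelian category that is Frobenius exact, and let X_1 ↪ X_2 ↪ ... ↪ X_{N−1} be a chain of monomorphisms in A. Then there exists an acyclic N-complex P• of projective-injective objects of A such that Z^0_j(P•) ≅ X_j compatibly with the given inclusions, for all 1 ≤ j ≤ N−1. -/
open CategoryTheory Limits

universe v u

variable {A : Type u} [Category.{v} A] [Abelian A]

/-- The composite of `r` consecutive differentials of an `N`-complex, starting in
degree `n`. -/
def dComp (X : ℤ → A) (d : ∀ n : ℤ, X n ⟶ X (n + 1)) (n : ℤ) :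
    ∀ r : ℕ, X n ⟶ X (n + r)
  | 0 => eqToHom (congrArg X (by simp))
  | (r + 1) => dComp X d n r ≫ d (n + r) ≫ eqToHom (congrArg X (by push_cast; ring))

/-- `(X, d)` is an `N`-complex: any composite of `N` consecutive differentials is zero. -/
def IsNComplex (X : ℤ → A) (d : ∀ n : ℤ, X n ⟶ X (n + 1)) (N : ℕ) : Prop :=
  ∀ n : ℤ, dComp X d n N = 0

/-- The `N`-complex `(X, d)` is acyclic: for all `n` and `1 ≤ r < N`, the cycles
`Z^n_r = ker(d^{n,r})` coincide with the boundaries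
`B^n_r = im(d^{n-(N-r), N-r})` as subobjects of `X n`. -/
def NAcyclic (X : ℤ → A) (d : ∀ n : ℤ, X n ⟶ X (n + 1)) (N : ℕ) : Prop :=
  ∀ (n : ℤ) (r : ℕ), 1 ≤ r → r < N →
    kernelSubobject (dComp X d n r) =
      imageSubobject (dComp X d (n - (N - r : ℕ)) (N - r) ≫ eqToHom (congrArg X (by ring)))

namespace NCx

theorem factors_iff_cokernel {X T : A} (S : Subobject X) (y : T ⟶ X) :
    S.Factors y ↔ y ≫ cokernel.π S.arrow = 0 := by
  constructor
  · intro h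
    rw [← S.factorThru_arrow y h, Category.assoc, cokernel.condition, comp_zero]
  · intro h
    rw [← Abelian.monoLift_comp S.arrow y h]
    exact Subobject.factors_comp_arrow _

theorem factors_of_epi {X T T' : A} (S : Subobject X) (y : T ⟶ X) (p : T' ⟶ T) [Epi p]
    (h : S.Factors (p ≫ y)) : S.Factors y := by
  rw [factors_iff_cokernel] at h ⊢
  rwa [Category.assoc, ← cancel_epi p, comp_zero] at *

theorem factors_image {X Y T : A} (f : X ⟶ Y) (y : T ⟶ Y) :
    (imageSubobject f).Factors y ↔
      ∃ (T' : A) (p : T' ⟶ T) (_ : Epi p) (x : T' ⟶ X), p ≫ y = x ≫ f := by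
  constructor
  · intro h
    obtain ⟨T', p, hp, x, hx⟩ := surjective_up_to_refinements_of_epi
      (factorThruImageSubobject f) ((imageSubobject f).factorThru y h)
    refine ⟨T', p, hp, x, ?_⟩
    have := congrArg (· ≫ (imageSubobject f).arrow) hx
    simpa using this
  · rintro ⟨T', p, hp, x, hx⟩
    apply factors_of_epi _ _ p
    rw [hx]
    exact imageSubobject_factors_comp_self _ _

theorem factors_pullback {X Y T : A} (f : X ⟶ Y) (S : Subobject Y) (y : T ⟶ X) :
    ((Subobject.pullback f).obj S).Factors y ↔ S.Factors (y ≫ f) := by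
  constructor
  · intro h
    rw [← Subobject.factorThru_arrow _ y h, Category.assoc, ← (Subobject.isPullback f S).w,
      ← Category.assoc]
    exact Subobject.factors_comp_arrow _
  · intro h
    have := (Subobject.isPullback f S).lift_snd (S.factorThru _ h) y (by simp)
    rw [← this]
    exact Subobject.factors_comp_arrow _

theorem ext_factors {X : A} {S S' : Subobject X}
    (h : ∀ (T : A) (y : T ⟶ X), S.Factors y ↔ S'.Factors y) : S = S' :=
  le_antisymm (Subobject.le_of_factors ((h _ _).1 (Subobject.factors_self _)))
    (Subobject.le_of_factors ((h _ _).2 (Subobject.factors_self _)))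

/-- A projective-injective object with a filtration of length `N`. -/
structure Flag (A : Type u) [Category.{v} A] [Abelian A] (N : ℕ) where
  P : A
  proj : Projective P
  inj : Injective P
  Z : ℕ → Subobject P
  mono : Monotone Z
  bot : Z 0 = ⊥
  top : ∀ j, N ≤ j → Z j = ⊤

/-- Consecutive flags. -/
structure Step {N : ℕ} (S S' : Flag A N) (d : S.P ⟶ S'.P) : Prop where
  pull : ∀ (j : ℕ) (T : A) (y : T ⟶ S.P), (S'.Z j).Factors (y ≫ d) ↔ (S.Z (j + 1)).Factors y
  img : ∀ (j : ℕ) (_ : j + 1 ≤ N) (T : A) (y : T ⟶ S'.P), (S'.Z j).Factors y →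
    ∃ (T' : A) (p : T' ⟶ T) (_ : Epi p) (x : T' ⟶ S.P), p ≫ y = x ≫ d

theorem exists_succ [EnoughInjectives A] (hfrob : ∀ X : A, Projective X ↔ Injective X)
    {N : ℕ} (hN : 0 < N) (S : Flag A N) : ∃ (S' : Flag A N) (d : S.P ⟶ S'.P), Step S S' d := by
  let d : S.P ⟶ Injective.under (cokernel (S.Z 1).arrow) :=
    cokernel.π (S.Z 1).arrow ≫ Injective.ι _
  have hd : ∀ (T : A) (y : T ⟶ S.P), y ≫ d = 0 ↔ (S.Z 1).Factors y := by
    intro T y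
    rw [factors_iff_cokernel, ← cancel_mono (Injective.ι (cokernel (S.Z 1).arrow))]
    simp [d]
  let Z : ℕ → Subobject (Injective.under (cokernel (S.Z 1).arrow)) := fun j =>
    if j < N then imageSubobject ((S.Z (j + 1)).arrow ≫ d) else ⊤
  have hZ : ∀ j, j < N → Z j = imageSubobject ((S.Z (j + 1)).arrow ≫ d) :=
    fun j hj => if_pos hj
  have hZ' : ∀ j, ¬ j < N → Z j = ⊤ := fun j hj => if_neg hj
  have hmono : Monotone Z := by
    apply monotone_nat_of_le_succ
    intro j
    by_cases h : j + 1 < N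
    · rw [hZ _ h, hZ _ (by omega)]
      apply imageSubobject_le (h := Subobject.ofLE _ _ (S.mono (Nat.le_succ (j + 1))) ≫
        factorThruImageSubobject _)
      simp
    · rw [hZ' _ h]
      exact le_top
  have hbot : Z 0 = ⊥ := by
    rw [hZ _ hN]
    have : (S.Z (0 + 1)).arrow ≫ d = 0 := (hd _ _).2 (Subobject.factors_self _)
    rw [this, imageSubobject_zero]
  refine ⟨⟨_, (hfrob _).2 inferInstance, inferInstance, Z, hmono, hbot,
    fun j hj => hZ' j (by omega)⟩, d, ?_, ?_⟩
  · intro j T y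
    change (Z j).Factors _ ↔ _
    by_cases h : j < N
    · rw [hZ _ h, factors_image]
      constructor
      · rintro ⟨T', p, hp, x, hx⟩
        apply factors_of_epi _ _ p
        have h1 : (S.Z 1).Factors (p ≫ y - x ≫ (S.Z (j + 1)).arrow) := by
          rw [← hd]
          simp [hx]
        have h2 := Subobject.factors_add _ _
          (Subobject.factors_of_le _ (S.mono (by omega : 1 ≤ j + 1)) h1)
          (Subobject.factors_comp_arrow (P := S.Z (j + 1)) x)
        simpa using h2
      · intro hy
        exact ⟨T, 𝟙 _, inferInstance, (S.Z (j + 1)).factorThru y hy, by simp⟩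
    · have h1 : S.Z (j + 1) = ⊤ := S.top _ (by omega)
      have h2 : (S.Z (j + 1)).Factors y := by
        rw [h1]
        exact Subobject.top_factors _
      rw [hZ' _ h]
      exact ⟨fun _ => h2, fun _ => Subobject.top_factors _⟩
  · intro j hj T y hy
    change (Z j).Factors _ at hy
    rw [hZ _ (by omega), factors_image] at hy
    obtain ⟨T', p, hp, x, hx⟩ := hy
    exact ⟨T', p, hp, x ≫ (S.Z (j + 1)).arrow, by simpa using hx⟩

theorem exists_pred [EnoughProjectives A] (hfrob : ∀ X : A, Projective X ↔ Injective X)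
    {N : ℕ} (S' : Flag A (N + 1)) : ∃ (S : Flag A (N + 1)) (d : S.P ⟶ S'.P), Step S S' d := by
  let d : Projective.over ((S'.Z N : Subobject S'.P) : A) ⟶ S'.P :=
    Projective.π _ ≫ (S'.Z N).arrow
  let Z : ℕ → Subobject (Projective.over ((S'.Z N : Subobject S'.P) : A)) := fun j =>
    match j with
    | 0 => ⊥
    | j + 1 => (Subobject.pullback d).obj (S'.Z j)
  have hmono : Monotone Z := by
    apply monotone_nat_of_le_succ
    intro j
    cases j with
    | zero => exact bot_le
    | succ j => exact ((Subobject.pullback d).map (homOfLE (S'.mono (Nat.le_succ j)))).le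
  refine ⟨⟨_, inferInstance, (hfrob _).1 inferInstance, Z, hmono, rfl, ?_⟩, d, ?_, ?_⟩
  · intro j hj
    obtain ⟨j, rfl⟩ : ∃ i, j = i + 1 := ⟨j - 1, by omega⟩
    apply ext_factors
    intro T y
    refine ⟨fun _ => Subobject.top_factors _, fun _ => ?_⟩
    refine (factors_pullback _ _ _).2 ?_
    apply Subobject.factors_of_le _ (S'.mono (by omega : N ≤ j))
    simp only [d, ← Category.assoc]
    exact Subobject.factors_comp_arrow _
  · intro j T y
    exact (factors_pullback _ _ _).symm
  · intro j hj T y hy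
    have hy' := Subobject.factors_of_le _ (S'.mono (by omega : j ≤ N)) hy
    obtain ⟨T', p, hp, x, hx⟩ := surjective_up_to_refinements_of_epi
      (Projective.π ((S'.Z N : Subobject S'.P) : A)) ((S'.Z N).factorThru y hy')
    refine ⟨T', p, hp, x, ?_⟩
    have := congrArg (· ≫ (S'.Z N).arrow) hx
    simpa [d] using this

theorem exists_seq {α : Type*} (R : α → α → Prop) (h1 : ∀ a, ∃ b, R a b) (h2 : ∀ b, ∃ a, R a b)
    (a : α) : ∃ f : ℤ → α, f 0 = a ∧ ∀ n, R (f n) (f (n + 1)) := by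
  choose s hs using h1
  choose p hp using h2
  let f : ℤ → α := fun n => match n with
    | Int.ofNat n => s^[n] a
    | Int.negSucc n => p^[n + 1] a
  refine ⟨f, rfl, fun n => ?_⟩
  match n with
  | Int.ofNat n =>
    change R (s^[n] a) (s^[n + 1] a)
    rw [Function.iterate_succ_apply']
    exact hs _
  | Int.negSucc 0 =>
    exact hp a
  | Int.negSucc (n + 1) =>
    change R (p^[n + 1 + 1] a) (p^[n + 1] a)
    rw [Function.iterate_succ_apply' p (n + 1)]
    exact hp _

section
variable {N : ℕ} (f : ℤ → Flag A N) (d : ∀ n, (f n).P ⟶ (f (n + 1)).P)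

theorem factors_eqToHom {m n : ℤ} (h : m = n) (j : ℕ) {T : A} (y : T ⟶ (f m).P)
    (h' : (f m).P = (f n).P) :
    ((f n).Z j).Factors (y ≫ eqToHom h') ↔ ((f m).Z j).Factors y := by
  subst h
  simp

theorem factors_dComp (hd : ∀ n, Step (f n) (f (n + 1)) (d n)) (n : ℤ) (r : ℕ) :
    ∀ (j : ℕ) (T : A) (y : T ⟶ (f n).P),
    ((f (n + r)).Z j).Factors (y ≫ dComp (fun n => (f n).P) d n r) ↔
      ((f n).Z (j + r)).Factors y := by
  induction r with
  | zero =>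
    intro j T y
    exact factors_eqToHom f (by simp) j y _
  | succ r ih =>
    intro j T y
    have h1 := factors_eqToHom f (m := n + r + 1) (n := n + (r + 1 : ℕ)) (by push_cast; ring) j
      ((y ≫ dComp (fun n => (f n).P) d n r) ≫ d (n + r)) (by congr 2; push_cast; ring)
    rw [(hd _).pull, ih, show j + 1 + r = j + (r + 1) by omega] at h1
    rw [← h1]
    simp only [dComp, Category.assoc]

theorem lift_dComp (hd : ∀ n, Step (f n) (f (n + 1)) (d n)) (n : ℤ) (r : ℕ) :
    ∀ (j : ℕ) (_ : j + r ≤ N) (T : A) (y : T ⟶ (f (n + r)).P), ((f (n + r)).Z j).Factors y →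
    ∃ (T' : A) (p : T' ⟶ T) (_ : Epi p) (x : T' ⟶ (f n).P),
      p ≫ y = x ≫ dComp (fun n => (f n).P) d n r := by
  induction r with
  | zero =>
    intro j hj T y hy
    exact ⟨T, 𝟙 _, inferInstance, y ≫ eqToHom (by simp), by simp [dComp]⟩
  | succ r ih =>
    intro j hj T y hy
    have e : n + (r + 1 : ℕ) = n + r + 1 := by push_cast; ring
    have e' : (f (n + (r + 1 : ℕ))).P = (f (n + r + 1)).P := by rw [e]
    have h1 := (factors_eqToHom f e j y e').2 hy
    obtain ⟨T', p, hp, x, hx⟩ := (hd (n + r)).img j (by omega) T _ h1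
    have h2 : ((f (n + r)).Z (j + 1)).Factors x := by
      rw [← (hd _).pull, ← hx]
      exact Subobject.factors_of_factors_right _ h1
    obtain ⟨T'', q, hq, z, hz⟩ := ih (j + 1) (by omega) T' x h2
    refine ⟨T'', q ≫ p, epi_comp _ _, z, ?_⟩
    have h3 : p ≫ y = x ≫ d (n + r) ≫ eqToHom e'.symm := by
      rw [← Category.assoc, ← hx]
      simp
    rw [Category.assoc, h3, ← Category.assoc, hz]
    simp only [dComp, Category.assoc]

theorem kernel_dComp (hd : ∀ n, Step (f n) (f (n + 1)) (d n)) (n : ℤ) (r : ℕ) :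
    kernelSubobject (dComp (fun n => (f n).P) d n r) = (f n).Z r := by
  apply ext_factors
  intro T y
  rw [kernelSubobject_factors_iff, ← Subobject.bot_factors_iff_zero]
  have := factors_dComp f d hd n r 0 T y
  rw [(f (n + r)).bot, Nat.zero_add] at this
  exact this

theorem image_dComp (hd : ∀ n, Step (f n) (f (n + 1)) (d n)) (n m : ℤ) (s r : ℕ)
    (h : r + s = N) (e : n + s = m) (e' : (f (n + s)).P = (f m).P) :
    imageSubobject (dComp (fun n => (f n).P) d n s ≫ eqToHom e') = (f m).Z r := by
  subst e
  apply ext_factors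
  intro T y
  rw [factors_image]
  simp only [eqToHom_refl, Category.comp_id]
  constructor
  · rintro ⟨T', p, hp, x, hx⟩
    apply factors_of_epi _ _ p
    rw [hx]
    refine (factors_dComp f d hd n s r T' x).2 ?_
    rw [(f n).top _ h.ge]
    exact Subobject.top_factors _
  · exact lift_dComp f d hd n s r h.le T y

end

theorem exists_starting_flag [EnoughInjectives A] (hfrob : ∀ X : A, Projective X ↔ Injective X)
    (k : ℕ) (X : Fin (k + 1) → A)
    (ι : ∀ j : Fin k, X j.castSucc ⟶ X j.succ)
    (hι : ∀ j, Mono (ι j)) :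
    ∃ (S : Flag A (k + 2)) (m : ∀ j, X j ⟶ S.P) (_ : ∀ j, Mono (m j)),
      (∀ j : Fin (k + 1), S.Z (j.val + 1) = Subobject.mk (m j)) ∧
      ∀ j : Fin k, ι j ≫ m j.succ = m j.castSucc := by
  let m : ∀ j, X j ⟶ Injective.under (X (Fin.last k)) := fun j =>
    Fin.reverseInduction (motive := fun j => X j ⟶ Injective.under (X (Fin.last k)))
      (Injective.ι _) (fun j g => ι j ≫ g) j
  have hm : ∀ j : Fin k, ι j ≫ m j.succ = m j.castSucc := fun j => by
    simp only [m, Fin.reverseInduction_castSucc]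
  have hmm : ∀ j, Mono (m j) := by
    intro j
    induction j using Fin.reverseInduction with
    | last =>
      simp only [m, Fin.reverseInduction_last]
      infer_instance
    | cast j ih =>
      rw [← hm]
      have := hι j
      exact mono_comp _ _
  let Z : ℕ → Subobject (Injective.under (X (Fin.last k))) := fun j =>
    match j with
    | 0 => ⊥
    | j + 1 => if h : j < k + 1 then Subobject.mk (m ⟨j, h⟩) else ⊤
  have hZ : ∀ j (h : j < k + 1), Z (j + 1) = Subobject.mk (m ⟨j, h⟩) := fun j h => dif_pos h
  have hZ' : ∀ j (_ : ¬ j < k + 1), Z (j + 1) = ⊤ := fun j h => dif_neg h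
  refine ⟨⟨_, (hfrob _).2 inferInstance, inferInstance, Z, ?_, rfl, ?_⟩, m, hmm,
    fun j => hZ j.1 j.2, hm⟩
  · apply monotone_nat_of_le_succ
    intro j
    cases j with
    | zero => exact bot_le
    | succ j =>
      by_cases h : j + 1 < k + 1
      · rw [hZ _ h, hZ _ (by omega)]
        exact Subobject.mk_le_mk_of_comm (ι ⟨j, by omega⟩) (hm ⟨j, by omega⟩)
      · rw [hZ' _ h]
        exact le_top
  · intro j hj
    obtain ⟨j, rfl⟩ : ∃ i, j = i + 1 := ⟨j - 1, by omega⟩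
    exact hZ' j (by omega)

end NCx

/-- Let `A` be a Frobenius exact abelian category (enough projectives and
injectives, projectives = injectives) and let `X 0 ↪ X 1 ↪ ... ↪ X k` be a chain of
monomorphisms in `A` (so, with `N = k + 2`, a chain `X_1 ↪ ... ↪ X_{N-1}`).  Then there
is an acyclic `N`-complex `P•` of projective–injective objects with
`Z^0_j(P•) ≅ X_j` compatibly with the given inclusions, for all `1 ≤ j ≤ N − 1`. -/
theorem exists_acyclic_ncomplex_extending_chain
    {A : Type u} [Category.{v} A] [Abelian A]
    [EnoughProjectives A] [EnoughInjectives A]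
    (hfrob : ∀ X : A, Projective X ↔ Injective X)
    (k : ℕ) (N : ℕ) (hN : N = k + 2)
    (X : Fin (k + 1) → A)
    (ι : ∀ j : Fin k, X j.castSucc ⟶ X j.succ)
    (hι : ∀ j, Mono (ι j)) :
    ∃ (P : ℤ → A) (d : ∀ n : ℤ, P n ⟶ P (n + 1)),
      IsNComplex P d N ∧
      (∀ n, Projective (P n) ∧ Injective (P n)) ∧
      NAcyclic P d N ∧
      ∃ e : ∀ j : Fin (k + 1), X j ≅ kernel (dComp P d 0 (j.val + 1)),
        ∀ j : Fin k,
          ι j ≫ (e j.succ).hom ≫ kernel.ι (dComp P d 0 (j.succ.val + 1)) =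
            (e j.castSucc).hom ≫ kernel.ι (dComp P d 0 (j.castSucc.val + 1)) := by
  subst hN
  obtain ⟨S, m, hmono, hmZ, hm⟩ := NCx.exists_starting_flag hfrob k X ι hι
  obtain ⟨f, rfl, hf⟩ := NCx.exists_seq (fun S S' : NCx.Flag A (k + 2) => ∃ d, NCx.Step S S' d)
    (NCx.exists_succ hfrob (by omega)) (NCx.exists_pred hfrob) S
  choose d hd using hf
  refine ⟨fun n => (f n).P, d, ?_, fun n => ⟨(f n).proj, (f n).inj⟩, ?_, ?_⟩
  · intro n
    have h := NCx.kernel_dComp f d hd n (k + 2)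
    rw [(f n).top _ le_rfl] at h
    have h2 := (kernelSubobject_factors_iff (dComp (fun n => (f n).P) d n (k + 2)) (𝟙 _)).1
      (by rw [h]; exact Subobject.top_factors _)
    rwa [Category.id_comp] at h2
  · intro n r hr hrN
    rw [NCx.kernel_dComp f d hd]
    exact (NCx.image_dComp f d hd _ _ _ r (by omega) (by ring) _).symm
  · have hk : ∀ j : Fin (k + 1), Subobject.mk (m j) =
        kernelSubobject (dComp (fun n => (f n).P) d 0 (j.val + 1)) := fun j => by
      rw [NCx.kernel_dComp f d hd, hmZ]
    let e : ∀ j : Fin (k + 1), X j ≅ kernel (dComp (fun n => (f n).P) d 0 (j.val + 1)) :=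
      fun j => (Subobject.underlyingIso (m j)).symm ≪≫ Subobject.isoOfEq _ _ (hk j) ≪≫
        kernelSubobjectIso _
    have he : ∀ j, (e j).hom ≫ kernel.ι (dComp (fun n => (f n).P) d 0 (j.val + 1)) = m j := by
      intro j
      simp [e]
    exact ⟨e, fun j => by rw [he, he, hm]⟩
end

section
/- Let A be an abelian category, X• an N-complex, P• a bounded-above N-complex of projectives, and I• a bounded-below N-complex of injectives. Then every morphism P• → X• in the derived category D_N(A) is represented by an actual morphism of N-complexes (up to homotopy), and likewise every morphism X• → I• in D_N(A) is represented by a morphism of N-complexes. -/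
open CategoryTheory Category Limits

universe v u

variable {A : Type u} [Category.{v} A] [Abelian A]

lemma d_congr (X : ℤ → A) (d : ∀ n : ℤ, X n ⟶ X (n + 1)) {p q : ℤ} (h : p = q) :
    d p = eqToHom (congrArg X h) ≫ d q ≫ eqToHom (congrArg X (by rw [h])) := by
  subst h; simp

lemma dComp_congr (X : ℤ → A) (d : ∀ n : ℤ, X n ⟶ X (n + 1)) {p q : ℤ} (h : p = q) (r : ℕ) :
    dComp X d p r =
      eqToHom (congrArg X h) ≫ dComp X d q r ≫ eqToHom (congrArg X (by rw [h])) := by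
  subst h; simp

lemma dComp_add (X : ℤ → A) (d : ∀ n : ℤ, X n ⟶ X (n + 1)) (n : ℤ) (a b : ℕ) :
    dComp X d n (a + b) =
      dComp X d n a ≫ dComp X d (n + a) b ≫ eqToHom (congrArg X (by push_cast; ring)) := by
  induction b with
  | zero => simp [dComp]
  | succ b ih =>
      show dComp X d n ((a + b) + 1) = _
      rw [dComp, ih, dComp]
      rw [d_congr X d (show n + (a:ℤ) + (b:ℤ) = n + ((a + b : ℕ) : ℤ) by push_cast; ring)]
      simp [eqToHom_trans, Category.assoc]

/-- An `N`-complex over `A`: any composite of `N` consecutive differentials is zero. -/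
structure NComplex (A : Type u) [Category.{v} A] [Abelian A] (N : ℕ) where
  X : ℤ → A
  d : ∀ n : ℤ, X n ⟶ X (n + 1)
  dN : ∀ n : ℤ, dComp X d n N = 0

namespace NComplex

variable {N : ℕ}

/-- Morphisms of `N`-complexes. -/
@[ext]
structure Hom (P Q : NComplex A N) where
  app : ∀ n : ℤ, P.X n ⟶ Q.X n
  comm : ∀ n : ℤ, app n ≫ Q.d n = P.d n ≫ app (n + 1)

instance : Category (NComplex A N) where
  Hom := Hom
  id P := ⟨fun _ => 𝟙 _, by intro n; simp⟩
  comp f g := ⟨fun n => f.app n ≫ g.app n, by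
    intro n
    rw [Category.assoc, g.comm, ← Category.assoc, f.comm, Category.assoc]⟩
  id_comp f := by apply Hom.ext; funext n; exact Category.id_comp _
  comp_id f := by apply Hom.ext; funext n; exact Category.comp_id _
  assoc f g h := by apply Hom.ext; funext n; exact Category.assoc _ _ _

@[simp] lemma id_app (P : NComplex A N) (n : ℤ) : (Hom.app (𝟙 P)) n = 𝟙 (P.X n) := rfl

@[simp] lemma comp_app {P Q R : NComplex A N} (f : P ⟶ Q) (g : Q ⟶ R) (n : ℤ) :
    (f ≫ g).app n = f.app n ≫ g.app n := rfl

lemma app_eqToHom {P Q : NComplex A N} (f : P ⟶ Q) {p q : ℤ} (h : p = q) :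
    f.app p ≫ eqToHom (congrArg Q.X h) = eqToHom (congrArg P.X h) ≫ f.app q := by
  subst h; simp

lemma dComp_naturality {P Q : NComplex A N} (f : P ⟶ Q) (n : ℤ) (r : ℕ) :
    f.app n ≫ dComp Q.X Q.d n r = dComp P.X P.d n r ≫ f.app (n + r) := by
  induction r with
  | zero =>
      show f.app n ≫ eqToHom _ = eqToHom _ ≫ f.app (n + (0:ℕ))
      exact app_eqToHom f (by simp)
  | succ r ih =>
      rw [dComp, dComp, ← Category.assoc, ih]
      rw [Category.assoc, Category.assoc]
      congr 1
      rw [← Category.assoc, f.comm (n + r), Category.assoc, Category.assoc]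
      congr 1
      exact app_eqToHom f (by push_cast; ring)

/-- Composites of complementary lengths multiply to zero in an `N`-complex. -/
lemma dComp_comp_dComp_eq_zero (P : NComplex A N) (m : ℤ) (a b : ℕ) (h : a + b = N) :
    dComp P.X P.d m a ≫ dComp P.X P.d (m + a) b = 0 := by
  subst h
  have hadd := dComp_add P.X P.d m a b
  rw [P.dN] at hadd
  have h1 : (dComp P.X P.d m a ≫ dComp P.X P.d (m + a) b) ≫
      eqToHom (congrArg P.X (by push_cast; ring) : P.X (m + a + b) = P.X (m + (a + b : ℕ))) =
      0 ≫ eqToHom (congrArg P.X (by push_cast; ring) :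
        P.X (m + a + b) = P.X (m + (a + b : ℕ))) := by
    rw [zero_comp, Category.assoc]
    exact hadd.symm
  exact (cancel_mono _).mp h1

/-- The short complex `X^{n-(N-r)} → X^n → X^{n+r}` given by
`d^{n-(N-r),N-r}` and `d^{n,r}`, for `r ≤ N`. -/
def sc (P : NComplex A N) (n : ℤ) (r : ℕ) (hr : r ≤ N) : ShortComplex A :=
  ShortComplex.mk
    (dComp P.X P.d (n - (N - r : ℕ)) (N - r) ≫ eqToHom (congrArg P.X (by ring)))
    (dComp P.X P.d n r)
    (by
      have h : n = (n - ((N - r : ℕ) : ℤ)) + ((N - r : ℕ) : ℤ) := by ring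
      rw [dComp_congr P.X P.d h r]
      simp only [Category.assoc, eqToHom_trans, eqToHom_trans_assoc, eqToHom_refl, Category.id_comp]
      rw [← Category.assoc,
        dComp_comp_dComp_eq_zero P _ (N - r) r (Nat.sub_add_cancel hr), zero_comp])

end NComplex

namespace NComplex

variable {N : ℕ}

/-- The morphism of short complexes induced by a morphism of `N`-complexes. -/
def scHom {P Q : NComplex A N} (f : P ⟶ Q) (n : ℤ) (r : ℕ) (hr : r ≤ N) :
    sc P n r hr ⟶ sc Q n r hr where
  τ₁ := f.app (n - (N - r : ℕ))
  τ₂ := f.app n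
  τ₃ := f.app (n + r)
  comm₁₂ := by
    show f.app _ ≫ dComp Q.X Q.d _ _ ≫ eqToHom _ =
      (dComp P.X P.d _ _ ≫ eqToHom _) ≫ f.app n
    rw [← Category.assoc, dComp_naturality f, Category.assoc, Category.assoc]
    congr 1
    exact app_eqToHom f (by ring)
  comm₂₃ := by
    show f.app n ≫ dComp Q.X Q.d n r = dComp P.X P.d n r ≫ f.app (n + r)
    exact dComp_naturality f n r

/-- Quasi-isomorphisms of `N`-complexes: morphisms inducing isomorphisms on all
homologies `H^n_r`, `1 ≤ r < N`. -/
def qis (A : Type u) [Category.{v} A] [Abelian A] (N : ℕ) :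
    MorphismProperty (NComplex A N) :=
  fun _ _ f => ∀ (n : ℤ) (r : ℕ) (_h1 : 1 ≤ r) (h2 : r < N),
    IsIso (ShortComplex.homologyMap (scHom f n r h2.le))

end NComplex

section Aux

/-- Representability of all morphisms out of `P` in a localization, from a lifting property. -/
lemma rep_left {C : Type*} [Category C] (W : MorphismProperty C) (P : C)
    (H : ∀ (Z X : C) (w : Z ⟶ X) (_ : W w) (f : P ⟶ X),
      ∃ g : P ⟶ Z, W.Q.map g ≫ W.Q.map w = W.Q.map f) (X : C)
    (φ : W.Q.obj P ⟶ W.Q.obj X) : ∃ f : P ⟶ X, W.Q.map f = φ := by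
  let Rep : ∀ {a : W.Localization} (_ : W.Q.obj P ⟶ a), Prop := fun {a} x =>
    ∃ (Y : C) (h : W.Q.obj Y = a) (f : P ⟶ Y), x = W.Q.map f ≫ eqToHom h
  let T : MorphismProperty W.Localization := fun a b φ =>
    ∀ x : W.Q.obj P ⟶ a, Rep x → Rep (x ≫ φ)
  have : T.IsStableUnderComposition := ⟨fun f g hf hg x hx => by
    rw [← Category.assoc]; exact hg _ (hf _ hx)⟩
  have hT : T = ⊤ := by
    apply Localization.Construction.morphismProperty_eq_top
    · rintro X Y f x ⟨Y', h, g, rfl⟩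
      obtain rfl := (Localization.Construction.objEquiv W).injective h
      exact ⟨Y, rfl, g ≫ f, by simp⟩
    · rintro X Y w hw x ⟨Y', h, g, rfl⟩
      obtain rfl := (Localization.Construction.objEquiv W).injective h
      obtain ⟨g', hg'⟩ := H _ _ w hw g
      refine ⟨X, rfl, g', ?_⟩
      simp only [eqToHom_refl, Category.comp_id]
      rw [← hg']
      exact (Iso.comp_inv_eq (Localization.Construction.wIso w hw)).2 rfl
  have h1 : T φ := by rw [hT]; trivial
  obtain ⟨Y, h, f, hf⟩ := h1 (𝟙 _) ⟨P, rfl, 𝟙 _, by simp⟩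
  obtain rfl := (Localization.Construction.objEquiv W).injective h
  exact ⟨f, by simpa using hf.symm⟩

/-- Dual of `rep_left`. -/
lemma rep_right {C : Type*} [Category C] (W : MorphismProperty C) (I : C)
    (H : ∀ (X Z : C) (w : X ⟶ Z) (_ : W w) (f : X ⟶ I),
      ∃ g : Z ⟶ I, W.Q.map w ≫ W.Q.map g = W.Q.map f) (X : C)
    (φ : W.Q.obj X ⟶ W.Q.obj I) : ∃ f : X ⟶ I, W.Q.map f = φ := by
  let Rep : ∀ {a : W.Localization} (_ : a ⟶ W.Q.obj I), Prop := fun {a} x =>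
    ∃ (Y : C) (h : a = W.Q.obj Y) (f : Y ⟶ I), x = eqToHom h ≫ W.Q.map f
  let T : MorphismProperty W.Localization := fun a b φ =>
    ∀ x : b ⟶ W.Q.obj I, Rep x → Rep (φ ≫ x)
  have : T.IsStableUnderComposition := ⟨fun f g hf hg x hx => by
    rw [Category.assoc]; exact hf _ (hg _ hx)⟩
  have hT : T = ⊤ := by
    apply Localization.Construction.morphismProperty_eq_top
    · rintro X Y f x ⟨Y', h, g, rfl⟩
      obtain rfl := (Localization.Construction.objEquiv W).injective h
      exact ⟨X, rfl, f ≫ g, by simp⟩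
    · rintro X Y w hw x ⟨Y', h, g, rfl⟩
      obtain rfl := (Localization.Construction.objEquiv W).injective h
      obtain ⟨g', hg'⟩ := H _ _ w hw g
      refine ⟨Y, rfl, g', ?_⟩
      simp only [eqToHom_refl, Category.id_comp]
      rw [← hg']
      exact (Iso.inv_comp_eq (Localization.Construction.wIso w hw)).2 rfl
  have h1 : T φ := by rw [hT]; trivial
  obtain ⟨Y, h, f, hf⟩ := h1 (𝟙 _) ⟨I, rfl, 𝟙 _, by simp⟩
  obtain rfl := (Localization.Construction.objEquiv W).injective h
  exact ⟨f, by simpa using hf.symm⟩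

/-- Descending construction of a family indexed by `ℤ`. -/
lemma desc_family {F : ℤ → Type*} (R : ∀ n, F n → F (n + 1) → Prop) (m : ℤ) (g0 : ∀ n, F n)
    (h0 : ∀ n, m ≤ n → R n (g0 n) (g0 (n + 1)))
    (step : ∀ (k : ℤ) (g : ∀ n, F n), (∀ n, k + 1 ≤ n → R n (g n) (g (n + 1))) →
      ∃ x : F k, R k x (g (k + 1))) :
    ∃ g : ∀ n, F n, ∀ n, R n (g n) (g (n + 1)) := by
  have step' : ∀ (k : ℤ) (g : ∀ n, F n), ∃ g' : ∀ n, F n, (∀ n, k < n → g' n = g n) ∧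
      ((∀ n, k + 1 ≤ n → R n (g n) (g (n + 1))) → ∀ n, k ≤ n → R n (g' n) (g' (n + 1))) := by
    intro k g
    by_cases h : ∀ n, k + 1 ≤ n → R n (g n) (g (n + 1))
    · obtain ⟨x, hx⟩ := step k g h
      have hne : ∀ n, k < n → Function.update g k x n = g n := fun n hn =>
        Function.update_of_ne (by omega) _ _
      refine ⟨Function.update g k x, hne, fun _ n hn => ?_⟩
      rcases hn.eq_or_lt with rfl | hn
      · rw [hne (k + 1) (by omega), Function.update_self]; exact hx
      · rw [hne n hn, hne (n + 1) (by omega)]; exact h n hn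
    · exact ⟨g, fun _ _ => rfl, fun h' => absurd h' h⟩
  choose S hS1 hS2 using step'
  let G : ℕ → ∀ n, F n := fun i => Nat.rec g0 (fun i g => S (m - (i + 1)) g) i
  have hG : ∀ i, G (i + 1) = S (m - (i + 1)) (G i) := fun i => rfl
  have hgood : ∀ (i : ℕ) n, m - i ≤ n → R n (G i n) (G i (n + 1)) := by
    intro i
    induction i with
    | zero => intro n hn; exact h0 n (by simpa using hn)
    | succ i ih =>
      intro n hn
      rw [hG]
      exact hS2 _ _ (fun n hn => ih n (by omega)) n (by push_cast at hn; exact hn)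
  have hstab : ∀ (i j : ℕ) n, m - i ≤ n → G (i + j) n = G i n := by
    intro i j n hn
    induction j with
    | zero => rfl
    | succ j ih =>
      rw [← ih, ← add_assoc, hG]
      exact hS1 _ _ _ (by push_cast; omega)
  have hst : ∀ (i : ℕ) n, m - i ≤ n → G (m - n).toNat n = G i n := by
    intro i n hn
    obtain ⟨j, hj⟩ : ∃ j, i = (m - n).toNat + j := ⟨i - (m - n).toNat, by omega⟩
    rw [hj, hstab _ _ _ (by omega)]
  refine ⟨fun n => G (m - n).toNat n, fun n => ?_⟩
  show R n (G (m - n).toNat n) (G (m - (n + 1)).toNat (n + 1))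
  rw [hst (m - n).toNat (n + 1) (by omega)]
  exact hgood _ _ (by omega)

/-- Ascending construction of a family indexed by `ℤ`. -/
lemma asc_family {F : ℤ → Type*} (R : ∀ n, F n → F (n + 1) → Prop) (m : ℤ) (g0 : ∀ n, F n)
    (h0 : ∀ n, n < m → R n (g0 n) (g0 (n + 1)))
    (step : ∀ (k : ℤ) (g : ∀ n, F n), (∀ n, n < k → R n (g n) (g (n + 1))) →
      ∃ x : F (k + 1), R k (g k) x) :
    ∃ g : ∀ n, F n, ∀ n, R n (g n) (g (n + 1)) := by
  have step' : ∀ (k : ℤ) (g : ∀ n, F n), ∃ g' : ∀ n, F n, (∀ n, n ≤ k → g' n = g n) ∧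
      ((∀ n, n < k → R n (g n) (g (n + 1))) → ∀ n, n < k + 1 → R n (g' n) (g' (n + 1))) := by
    intro k g
    by_cases h : ∀ n, n < k → R n (g n) (g (n + 1))
    · obtain ⟨x, hx⟩ := step k g h
      have hne : ∀ n, n ≤ k → Function.update g (k + 1) x n = g n := fun n hn =>
        Function.update_of_ne (by omega) _ _
      refine ⟨Function.update g (k + 1) x, hne, fun _ n hn => ?_⟩
      rcases (Int.lt_add_one_iff.1 hn).eq_or_lt with rfl | hn
      · rw [hne _ (by omega), Function.update_self]; exact hx
      · rw [hne n (by omega), hne (n + 1) (by omega)]; exact h n hn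
    · exact ⟨g, fun _ _ => rfl, fun h' => absurd h' h⟩
  choose S hS1 hS2 using step'
  let G : ℕ → ∀ n, F n := fun i => Nat.rec g0 (fun i g => S (m + i) g) i
  have hG : ∀ i, G (i + 1) = S (m + i) (G i) := fun i => rfl
  have hgood : ∀ (i : ℕ) n, n < m + i → R n (G i n) (G i (n + 1)) := by
    intro i
    induction i with
    | zero => intro n hn; exact h0 n (by simpa using hn)
    | succ i ih =>
      intro n hn
      rw [hG]
      exact hS2 _ _ (fun n hn => ih n (by omega)) n (by push_cast at hn; omega)
  have hstab : ∀ (i j : ℕ) n, n ≤ m + i → G (i + j) n = G i n := by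
    intro i j n hn
    induction j with
    | zero => rfl
    | succ j ih =>
      rw [← ih, ← add_assoc, hG]
      exact hS1 _ _ _ (by push_cast; omega)
  have hst : ∀ (i : ℕ) n, n ≤ m + i → G (n - m).toNat n = G i n := by
    intro i n hn
    obtain ⟨j, hj⟩ : ∃ j, i = (n - m).toNat + j := ⟨i - (n - m).toNat, by omega⟩
    rw [hj, hstab _ _ _ (by omega)]
  refine ⟨fun n => G (n - m).toNat n, fun n => ?_⟩
  show R n (G (n - m).toNat n) (G (n + 1 - m).toNat (n + 1))
  rw [hst (n + 1 - m).toNat n (by omega)]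
  exact hgood _ _ (by omega)

end Aux

namespace NComplex

variable {N : ℕ}

/-- The composite differential from degree `p` to degree `q` (zero if `q < p`). -/
noncomputable def dd (X : NComplex A N) (p q : ℤ) : X.X p ⟶ X.X q :=
  if h : p ≤ q then dComp X.X X.d p (q - p).toNat ≫ eqToHom (congrArg X.X (by omega)) else 0

lemma dd_eq (X : NComplex A N) {p q : ℤ} (r : ℕ) (h : p + r = q) :
    X.dd p q = dComp X.X X.d p r ≫ eqToHom (congrArg X.X h) := by
  obtain rfl : r = (q - p).toNat := by omega
  rw [dd, dif_pos (by omega)]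

lemma dd_add (X : NComplex A N) (p : ℤ) (r : ℕ) : X.dd p (p + r) = dComp X.X X.d p r := by
  rw [dd_eq X r rfl]; simp

@[simp] lemma dd_self (X : NComplex A N) (p : ℤ) : X.dd p p = 𝟙 _ := by
  rw [dd_eq X 0 (by simp)]; simp [dComp]

lemma dd_d (X : NComplex A N) (p q : ℤ) (h : p ≤ q) : X.dd p q ≫ X.d q = X.dd p (q + 1) := by
  obtain ⟨r, rfl⟩ : ∃ r : ℕ, q = p + r := ⟨(q - p).toNat, by omega⟩
  rw [dd_add, dd_eq X (r + 1) (by push_cast; ring), dComp]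
  simp

@[simp] lemma dd_one (X : NComplex A N) (p : ℤ) : X.dd p (p + 1) = X.d p := by
  rw [← dd_d X p p le_rfl]; simp

lemma dd_comp (X : NComplex A N) (p q r : ℤ) (h : p ≤ q) (h' : q ≤ r) :
    X.dd p q ≫ X.dd q r = X.dd p r := by
  obtain ⟨k, rfl⟩ : ∃ k : ℕ, r = q + k := ⟨(r - q).toNat, by omega⟩
  clear h'
  induction k with
  | zero =>
    obtain h : q + ((0 : ℕ) : ℤ) = q := by simp
    rw [h]; simp
  | succ k ih =>
    have e : q + ((k + 1 : ℕ) : ℤ) = q + k + 1 := by push_cast; ring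
    rw [e, ← dd_d _ _ _ (by omega), ← dd_d _ p _ (by omega), ← Category.assoc, ih]

lemma dd_zero (X : NComplex A N) (p q : ℤ) (h : p + N ≤ q) : X.dd p q = 0 := by
  rw [← dd_comp X p (p + N) q (by omega) h, dd_add, X.dN, zero_comp]

lemma dd_nat {X Y : NComplex A N} (f : X ⟶ Y) (p q : ℤ) :
    f.app p ≫ Y.dd p q = X.dd p q ≫ f.app q := by
  by_cases h : p ≤ q
  · obtain ⟨r, rfl⟩ : ∃ r : ℕ, q = p + r := ⟨(q - p).toNat, by omega⟩
    rw [dd_add, dd_add, dComp_naturality]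
  · simp [dd, h]

lemma sc_f (X : NComplex A N) (n : ℤ) (r : ℕ) (hr : r ≤ N) :
    (sc X n r hr).f = X.dd (n - (N - r : ℕ)) n :=
  (dd_eq X (N - r) (by ring)).symm

lemma sc_g (X : NComplex A N) (n : ℤ) (r : ℕ) (hr : r ≤ N) :
    (sc X n r hr).g = X.dd n (n + r) :=
  (dd_add X n r).symm

lemma qis_inj {Z X : NComplex A N} {w : Z ⟶ X} (hw : qis A N w) (a b c : ℤ) (hab : a < b)
    (hbc : b < c) (hac : a + N = c) {T : A} (x : T ⟶ Z.X b) (hx : x ≫ Z.dd b c = 0)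
    (y : T ⟶ X.X a) (hy : x ≫ w.app b = y ≫ X.dd a b) :
    ∃ (T' : A) (π : T' ⟶ T) (_ : Epi π) (z : T' ⟶ Z.X a), π ≫ x = z ≫ Z.dd a b := by
  obtain ⟨r, rfl⟩ : ∃ r : ℕ, c = b + r := ⟨(c - b).toNat, by omega⟩
  have hr : r < N := by omega
  obtain rfl : a = b - (N - r : ℕ) := by omega
  have := hw b r (by omega) hr
  have hm : Mono (ShortComplex.homologyMap (scHom w b r hr.le)) := inferInstance
  rw [ShortComplex.mono_homologyMap_iff_up_to_refinements] at hm
  obtain ⟨T', π, hπ, z, hz⟩ := hm x (by rw [sc_g]; exact hx) y (by rw [sc_f]; exact hy)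
  exact ⟨T', π, hπ, z, by rw [sc_f] at hz; exact hz⟩

lemma qis_surj {Z X : NComplex A N} {w : Z ⟶ X} (hw : qis A N w) (a b c : ℤ) (hab : a < b)
    (hbc : b < c) (hac : a + N = c) {T : A} (y : T ⟶ X.X b) (hy : y ≫ X.dd b c = 0) :
    ∃ (T' : A) (π : T' ⟶ T) (_ : Epi π) (x : T' ⟶ Z.X b) (_ : x ≫ Z.dd b c = 0)
      (z : T' ⟶ X.X a), π ≫ y = x ≫ w.app b + z ≫ X.dd a b := by
  obtain ⟨r, rfl⟩ : ∃ r : ℕ, c = b + r := ⟨(c - b).toNat, by omega⟩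
  have hr : r < N := by omega
  obtain rfl : a = b - (N - r : ℕ) := by omega
  have := hw b r (by omega) hr
  have hm : Epi (ShortComplex.homologyMap (scHom w b r hr.le)) := inferInstance
  rw [ShortComplex.epi_homologyMap_iff_up_to_refinements] at hm
  obtain ⟨T', π, hπ, x, hx, z, hz⟩ := hm y (by rw [sc_g]; exact hy)
  refine ⟨T', π, hπ, x, ?_, z, ?_⟩
  · rw [sc_g] at hx; exact hx
  · rw [sc_f] at hz; exact hz

/-- A morphism with a retraction and surjective on homology is a quasi-isomorphism. -/
lemma qis_of_retract {Z Y : NComplex A N} (i : Z ⟶ Y) (p : Y ⟶ Z) (hip : i ≫ p = 𝟙 Z)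
    (H : ∀ (a b c : ℤ), a < b → b < c → a + N = c → ∀ {T : A} (y : T ⟶ Y.X b),
      y ≫ Y.dd b c = 0 → ∃ z : T ⟶ Y.X a, y = (y ≫ p.app b) ≫ i.app b + z ≫ Y.dd a b) :
    qis A N i := by
  intro n r h1 h2
  have hm : Mono (ShortComplex.homologyMap (scHom i n r h2.le)) := by
    have : ShortComplex.homologyMap (scHom i n r h2.le) ≫
        ShortComplex.homologyMap (scHom p n r h2.le) = 𝟙 _ := by
      rw [← ShortComplex.homologyMap_comp, ← ShortComplex.homologyMap_id]
      congr 1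
      have hk : ∀ k, i.app k ≫ p.app k = 𝟙 _ := fun k => by rw [← comp_app, hip]; rfl
      ext
      · exact hk _
      · exact hk _
      · exact hk _
    exact mono_of_mono_fac this
  have he : Epi (ShortComplex.homologyMap (scHom i n r h2.le)) := by
    rw [ShortComplex.epi_homologyMap_iff_up_to_refinements]
    intro T (y : T ⟶ Y.X n) hy
    replace hy : y ≫ Y.dd n (n + r) = 0 := by rw [sc_g] at hy; exact hy
    obtain ⟨z, hz⟩ := H (n - (N - r : ℕ)) n (n + r) (by omega) (by omega) (by omega) y hy
    refine ⟨T, 𝟙 _, inferInstance, y ≫ p.app n, ?_, z, ?_⟩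
    · rw [sc_g]
      have : (y ≫ p.app n) ≫ Z.dd n (n + r) = 0 := by
        rw [Category.assoc, dd_nat, ← Category.assoc, hy, zero_comp]
      exact this
    · rw [sc_f]
      exact (Category.id_comp y).trans hz
  exact isIso_of_mono_of_epi _

lemma qis_of_comp {X Y Z : NComplex A N} (f : X ⟶ Y) (g : Y ⟶ Z) (hf : qis A N f)
    (hfg : qis A N (f ≫ g)) : qis A N g := by
  intro n r h1 h2
  have h3 := hf n r h1 h2
  have h4 := hfg n r h1 h2
  have e : ShortComplex.homologyMap (scHom (f ≫ g) n r h2.le) =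
    ShortComplex.homologyMap (scHom f n r h2.le) ≫
      ShortComplex.homologyMap (scHom g n r h2.le) := by
    rw [← ShortComplex.homologyMap_comp]; rfl
  rw [e] at h4
  exact IsIso.of_isIso_comp_left (ShortComplex.homologyMap (scHom f n r h2.le)) _

lemma qis_of_comp' {X Y Z : NComplex A N} (f : X ⟶ Y) (g : Y ⟶ Z) (hg : qis A N g)
    (hfg : qis A N (f ≫ g)) : qis A N f := by
  intro n r h1 h2
  have h3 := hg n r h1 h2
  have h4 := hfg n r h1 h2
  have e : ShortComplex.homologyMap (scHom (f ≫ g) n r h2.le) =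
    ShortComplex.homologyMap (scHom f n r h2.le) ≫
      ShortComplex.homologyMap (scHom g n r h2.le) := by
    rw [← ShortComplex.homologyMap_comp]; rfl
  rw [e] at h4
  exact IsIso.of_isIso_comp_right _ (ShortComplex.homologyMap (scHom g n r h2.le))

end NComplex

namespace NComplex

variable {N : ℕ}

/-- The index set of the contractible complex in degree `k`. -/
abbrev Ix (N : ℕ) (s k : ℤ) : Type := {q : ℤ // k + s - N < q ∧ q ≤ k + s}

instance (N : ℕ) (s k : ℤ) : Finite (Ix N s k) :=
  (Set.finite_Ioc (k + s - N) (k + s)).to_subtype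

instance (X : NComplex A N) (s k : ℤ) : HasBiproduct (fun q : Ix N s k => X.X q) := by
  have := Abelian.hasFiniteBiproducts (C := A)
  infer_instance

/-- The objects of the contractible complex. -/
noncomputable abbrev cObj (X : NComplex A N) (s k : ℤ) : A :=
  ⨁ fun q : Ix N s k => X.X q

/-- Inclusion of a summand (zero outside the range). -/
noncomputable def cι (X : NComplex A N) (s k q : ℤ) : X.X q ⟶ cObj X s k :=
  open Classical in
  if h : k + s - N < q ∧ q ≤ k + s then
    biproduct.ι (fun q : Ix N s k => X.X q) ⟨q, h⟩ else 0

/-- Projection to a summand (zero outside the range). -/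
noncomputable def cπ (X : NComplex A N) (s k q : ℤ) : cObj X s k ⟶ X.X q :=
  open Classical in
  if h : k + s - N < q ∧ q ≤ k + s then
    biproduct.π (fun q : Ix N s k => X.X q) ⟨q, h⟩ else 0

lemma cι_cπ (X : NComplex A N) (s k q : ℤ) (h : k + s - N < q ∧ q ≤ k + s) :
    cι X s k q ≫ cπ X s k q = 𝟙 _ := by
  rw [cι, cπ, dif_pos h, dif_pos h]
  exact biproduct.ι_π_self (fun q : Ix N s k => X.X q) ⟨q, h⟩

lemma cπ_zero (X : NComplex A N) (s k q : ℤ) (h : ¬ (k + s - N < q ∧ q ≤ k + s)) :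
    cπ X s k q = 0 := by
  rw [cπ, dif_neg h]

lemma cι_zero (X : NComplex A N) (s k q : ℤ) (h : ¬ (k + s - N < q ∧ q ≤ k + s)) :
    cι X s k q = 0 := by
  rw [cι, dif_neg h]

lemma cι_cπ_ne (X : NComplex A N) (s k p q : ℤ) (h : p ≠ q) :
    cι X s k p ≫ cπ X s k q = 0 := by
  classical
  unfold cι cπ
  split_ifs with h1 h2
  · exact biproduct.ι_π_ne (fun q : Ix N s k => X.X q) (j := ⟨p, h1⟩) (j' := ⟨q, h2⟩)
      (fun h3 => h (congrArg Subtype.val h3))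
  all_goals simp

lemma c_hom_ext (X : NComplex A N) (s k : ℤ) {T : A} (f g : T ⟶ cObj X s k)
    (h : ∀ q, k + s - N < q → q ≤ k + s → f ≫ cπ X s k q = g ≫ cπ X s k q) : f = g := by
  refine biproduct.hom_ext _ _ (fun q => ?_)
  have := h q.1 q.2.1 q.2.2
  rw [cπ, dif_pos q.2] at this
  exact this

lemma c_hom_ext' (X : NComplex A N) (s k : ℤ) {T : A} (f g : cObj X s k ⟶ T)
    (h : ∀ q, k + s - N < q → q ≤ k + s → cι X s k q ≫ f = cι X s k q ≫ g) : f = g := by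
  refine biproduct.hom_ext' _ _ (fun q => ?_)
  have := h q.1 q.2.1 q.2.2
  rw [cι, dif_pos q.2] at this
  exact this

/-- Transition maps. -/
noncomputable def τ (X : NComplex A N) (s a b : ℤ) : cObj X s a ⟶ cObj X s b :=
  biproduct.lift fun q : Ix N s b => cπ X s a q

lemma τ_cπ (X : NComplex A N) (s a b q : ℤ) (h : b + s - N < q) (h' : q ≤ b + s) :
    τ X s a b ≫ cπ X s b q = cπ X s a q := by
  have h : b + s - N < q ∧ q ≤ b + s := ⟨h, h'⟩
  rw [cπ, dif_pos h, τ, biproduct.lift_π]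

lemma cι_τ (X : NComplex A N) (s a b q : ℤ) (h : a + s - N < q) (h' : q ≤ a + s) :
    cι X s a q ≫ τ X s a b = cι X s b q := by
  apply c_hom_ext
  intro p hp hp'
  rw [Category.assoc, τ_cπ _ _ _ _ _ hp hp']
  by_cases hpq : q = p
  · subst hpq
    rw [cι_cπ _ _ _ _ ⟨h, h'⟩, cι_cπ _ _ _ _ ⟨hp, hp'⟩]
  · rw [cι_cπ_ne _ _ _ _ _ hpq, cι_cπ_ne _ _ _ _ _ hpq]

lemma τ_self (X : NComplex A N) (s a : ℤ) : τ X s a a = 𝟙 _ := by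
  apply c_hom_ext
  intro q h h'
  rw [τ_cπ _ _ _ _ _ h h', Category.id_comp]

lemma τ_comp (X : NComplex A N) (s a b c : ℤ) (h : a ≤ b) (h' : b ≤ c) :
    τ X s a b ≫ τ X s b c = τ X s a c := by
  apply c_hom_ext
  intro q h1 h2
  rw [Category.assoc, τ_cπ _ _ _ _ _ h1 h2, τ_cπ _ _ _ _ _ h1 h2]
  by_cases h3 : b + s - N < q ∧ q ≤ b + s
  · rw [τ_cπ _ _ _ _ _ h3.1 h3.2]
  · rw [cπ_zero _ _ _ _ h3, comp_zero, cπ_zero]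
    omega

lemma τ_zero (X : NComplex A N) (s a b : ℤ) (h : a + N ≤ b) : τ X s a b = 0 := by
  apply c_hom_ext
  intro q h1 h2
  rw [τ_cπ _ _ _ _ _ h1 h2, cπ_zero, zero_comp]
  omega

lemma τ_eqToHom (X : NComplex A N) (s a b c : ℤ) (h : b = c) :
    τ X s a b ≫ eqToHom (congrArg (cObj X s) h) = τ X s a c := by
  subst h; simp

lemma dComp_τ (X : NComplex A N) (s n : ℤ) (r : ℕ) :
    dComp (cObj X s) (fun k => τ X s k (k + 1)) n r = τ X s n (n + r) := by
  induction r with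
  | zero =>
    rw [dComp, ← τ_eqToHom X s n n _ (by simp), τ_self, Category.id_comp]
  | succ r ih =>
    rw [dComp, ih, τ_eqToHom X s _ _ _ (by push_cast; ring), τ_comp _ _ _ _ _ (by omega)
      (by push_cast; omega)]

/-- The contractible complex. -/
noncomputable def cone (X : NComplex A N) (s : ℤ) : NComplex A N where
  X := cObj X s
  d k := τ X s k (k + 1)
  dN n := by rw [dComp_τ, τ_zero _ _ _ _ le_rfl]

lemma cone_dd (X : NComplex A N) (s a b : ℤ) (h : a ≤ b) : (cone X s).dd a b = τ X s a b := by
  obtain ⟨r, rfl⟩ : ∃ r : ℕ, b = a + r := ⟨(b - a).toNat, by omega⟩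
  rw [dd_add]
  exact dComp_τ X s a r

lemma τ_exact (X : NComplex A N) (s a b c : ℤ) (h : a ≤ b) (h' : b ≤ c) (hac : a + N = c)
    {T : A} (x : T ⟶ cObj X s b) (hx : x ≫ τ X s b c = 0) :
    (x ≫ τ X s b a) ≫ τ X s a b = x := by
  apply c_hom_ext
  intro q h1 h2
  rw [Category.assoc, Category.assoc, τ_cπ _ _ _ _ _ h1 h2]
  by_cases h3 : a + s - N < q ∧ q ≤ a + s
  · rw [τ_cπ _ _ _ _ _ h3.1 h3.2]
  · rw [cπ_zero _ _ _ _ h3, comp_zero, comp_zero, ← τ_cπ X s b c q (by omega) (by omega),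
      ← Category.assoc, hx, zero_comp]

lemma cone_exact (X : NComplex A N) (s a b c : ℤ) (h : a ≤ b) (h' : b ≤ c) (hac : a + N = c)
    {T : A} (x : T ⟶ (cone X s).X b) (hx : x ≫ (cone X s).dd b c = 0) :
    ∃ z : T ⟶ (cone X s).X a, z ≫ (cone X s).dd a b = x := by
  rw [cone_dd _ _ _ _ h'] at hx
  rw [cone_dd _ _ _ _ h]
  exact ⟨_, τ_exact X s a b c h h' hac x hx⟩

/-- The components of `conePr`. -/
noncomputable def prApp (X : NComplex A N) (k : ℤ) : cObj X 0 k ⟶ X.X k :=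
  biproduct.desc fun q : Ix N 0 k => X.dd q k

lemma cι_prApp (X : NComplex A N) (k q : ℤ) (h : k + 0 - N < q ∧ q ≤ k + 0) :
    cι X 0 k q ≫ prApp X k = X.dd q k := by
  rw [cι, dif_pos h]
  exact biproduct.ι_desc (fun q : Ix N 0 k => X.dd q k) ⟨q, h⟩

lemma prApp_comm (X : NComplex A N) (k : ℤ) :
    prApp X k ≫ X.d k = τ X 0 k (k + 1) ≫ prApp X (k + 1) := by
  apply c_hom_ext'
  intro q h1 h2
  rw [← Category.assoc, ← Category.assoc, cι_prApp _ _ _ ⟨h1, h2⟩, cι_τ _ _ _ _ _ h1 h2,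
    dd_d _ _ _ (by omega)]
  by_cases h3 : k + 1 + 0 - N < q ∧ q ≤ k + 1 + 0
  · rw [cι_prApp _ _ _ h3]
  · rw [cι_zero _ _ _ _ h3, dd_zero _ _ _ (by omega), zero_comp]

/-- The epimorphism from a contractible complex. -/
noncomputable def conePr (X : NComplex A N) : cone X 0 ⟶ X where
  app k := prApp X k
  comm k := prApp_comm X k

lemma conePr_epi (hN : 1 ≤ N) (X : NComplex A N) (k : ℤ) : Epi ((conePr X).app k) :=
  epi_of_epi_fac ((cι_prApp X k k (by omega)).trans (dd_self X k))

/-- The components of `coneIn`. -/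
noncomputable def inApp (X : NComplex A N) (k : ℤ) : X.X k ⟶ cObj X (N - 1) k :=
  biproduct.lift fun q : Ix N (N - 1) k => X.dd k q

lemma inApp_cπ (X : NComplex A N) (k q : ℤ) (h : k + (N - 1) - N < q ∧ q ≤ k + (N - 1)) :
    inApp X k ≫ cπ X (N - 1) k q = X.dd k q := by
  rw [cπ, dif_pos h]
  exact biproduct.lift_π (fun q : Ix N (N - 1) k => X.dd k q) ⟨q, h⟩

lemma inApp_comm (X : NComplex A N) (k : ℤ) :
    inApp X k ≫ τ X (N - 1) k (k + 1) = X.d k ≫ inApp X (k + 1) := by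
  apply c_hom_ext
  intro q h1 h2
  rw [Category.assoc, Category.assoc, inApp_cπ _ _ _ ⟨h1, h2⟩, τ_cπ _ _ _ _ _ h1 h2,
    ← dd_one, dd_comp _ _ _ _ (by omega) (by omega)]
  by_cases h3 : k + (N - 1) - N < q ∧ q ≤ k + (N - 1)
  · rw [inApp_cπ _ _ _ h3]
  · rw [cπ_zero _ _ _ _ h3, dd_zero _ _ _ (by omega), comp_zero]

/-- The monomorphism to a contractible complex. -/
noncomputable def coneIn (X : NComplex A N) : X ⟶ cone X (N - 1) where
  app k := inApp X k
  comm k := inApp_comm X k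

lemma coneIn_mono (hN : 1 ≤ N) (X : NComplex A N) (k : ℤ) : Mono ((coneIn X).app k) :=
  mono_of_mono_fac ((inApp_cπ X k k (by omega)).trans (dd_self X k))

lemma dComp_nat_raw {X Y : ℤ → A} (d : ∀ n, X n ⟶ X (n + 1)) (e : ∀ n, Y n ⟶ Y (n + 1))
    (f : ∀ n, X n ⟶ Y n) (h : ∀ n, f n ≫ e n = d n ≫ f (n + 1)) (n : ℤ) (r : ℕ) :
    f n ≫ dComp Y e n r = dComp X d n r ≫ f (n + r) := by
  have hc : ∀ {p q : ℤ} (h : p = q), f p ≫ eqToHom (congrArg Y h) =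
      eqToHom (congrArg X h) ≫ f q := by
    intro p q h; subst h; simp
  induction r with
  | zero => exact hc (by simp)
  | succ r ih =>
    rw [dComp, dComp, ← Category.assoc, ih, Category.assoc, Category.assoc, ← Category.assoc (f _),
      h, Category.assoc, Category.assoc, hc (by push_cast; ring)]

/-- Binary direct sum. -/
noncomputable def bi (Z C : NComplex A N) : NComplex A N where
  X n := Z.X n ⊞ C.X n
  d n := biprod.map (Z.d n) (C.d n)
  dN n := by
    apply biprod.hom_ext
    · rw [← dComp_nat_raw _ Z.d (fun n => (biprod.fst : Z.X n ⊞ C.X n ⟶ _)) (by simp), Z.dN]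
      simp
    · rw [← dComp_nat_raw _ C.d (fun n => (biprod.snd : Z.X n ⊞ C.X n ⟶ _)) (by simp), C.dN]
      simp

/-- First inclusion. -/
noncomputable def biInl (Z C : NComplex A N) : Z ⟶ bi Z C where
  app n := biprod.inl
  comm n := by simp [bi]

/-- Second inclusion. -/
noncomputable def biInr (Z C : NComplex A N) : C ⟶ bi Z C where
  app n := biprod.inr
  comm n := by simp [bi]

/-- First projection. -/
noncomputable def biFst (Z C : NComplex A N) : bi Z C ⟶ Z where
  app n := biprod.fst
  comm n := by simp [bi]

/-- Second projection. -/
noncomputable def biSnd (Z C : NComplex A N) : bi Z C ⟶ C where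
  app n := biprod.snd
  comm n := by simp [bi]

/-- Morphism out of the direct sum. -/
noncomputable def biDesc {Z C X : NComplex A N} (f : Z ⟶ X) (g : C ⟶ X) : bi Z C ⟶ X where
  app n := biprod.desc (f.app n) (g.app n)
  comm n := by
    apply biprod.hom_ext' <;> simp [bi, f.comm, g.comm]

/-- Morphism to the direct sum. -/
noncomputable def biLift {Z C X : NComplex A N} (f : X ⟶ Z) (g : X ⟶ C) : X ⟶ bi Z C where
  app n := biprod.lift (f.app n) (g.app n)
  comm n := by
    apply biprod.hom_ext <;> simp [bi, f.comm, g.comm]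

lemma biInl_fst (Z C : NComplex A N) : biInl Z C ≫ biFst Z C = 𝟙 Z := by
  apply Hom.ext; funext n; exact biprod.inl_fst

lemma biInl_desc {Z C X : NComplex A N} (f : Z ⟶ X) (g : C ⟶ X) : biInl Z C ≫ biDesc f g = f := by
  apply Hom.ext; funext n; exact biprod.inl_desc _ _

lemma biLift_fst {Z C X : NComplex A N} (f : X ⟶ Z) (g : X ⟶ C) : biLift f g ≫ biFst Z C = f := by
  apply Hom.ext; funext n; exact biprod.lift_fst _ _

lemma biInl_qis (Z X : NComplex A N) (s : ℤ) : qis A N (biInl Z (cone X s)) := by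
  refine qis_of_retract _ (biFst _ _) (biInl_fst _ _) ?_
  intro a b c hab hbc hac T y hy
  obtain ⟨z, hz⟩ := cone_exact X s a b c hab.le hbc.le hac (y ≫ (biSnd _ _).app b) (by
    rw [Category.assoc, dd_nat, ← Category.assoc, hy, zero_comp])
  refine ⟨z ≫ (biInr _ _).app a, ?_⟩
  rw [Category.assoc z, dd_nat, ← Category.assoc z, hz, Category.assoc, Category.assoc,
    ← Preadditive.comp_add]
  refine (Category.comp_id y).symm.trans (congrArg (y ≫ ·) ?_)
  exact biprod.total.symm

lemma biFst_qis (Z X : NComplex A N) (s : ℤ) : qis A N (biFst Z (cone X s)) := by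
  apply qis_of_comp _ _ (biInl_qis Z X s)
  rw [biInl_fst]
  intro n r _ _
  have : scHom (𝟙 Z) n r (by omega) = 𝟙 _ := rfl
  rw [this, ShortComplex.homologyMap_id]
  infer_instance

end NComplex

namespace NComplex

variable {N : ℕ}

lemma proj_step (hN : 2 ≤ N) {Z X : NComplex A N} (w : Z ⟶ X) (hw : qis A N w)
    (he : ∀ n, Epi (w.app n)) (n : ℤ) {T : A} [Projective T] (x : T ⟶ Z.X (n + 1))
    (hx : x ≫ w.app (n + 1) = 0) (hx' : x ≫ Z.dd (n + 1) (n + N) = 0) :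
    ∃ k : T ⟶ Z.X n, k ≫ w.app n = 0 ∧ k ≫ Z.d n = x := by
  obtain ⟨T₁, π₁, _, z, hz⟩ := qis_inj hw n (n + 1) (n + N) (by omega) (by omega) rfl x hx' 0
    (by rw [hx, zero_comp])
  obtain ⟨T₂, π₂, _, z', hz', y, hy⟩ := qis_surj hw (n + 1 - N) n (n + 1) (by omega) (by omega)
    (by omega) (z ≫ w.app n) (by
      rw [Category.assoc, dd_nat, ← Category.assoc, ← hz, Category.assoc, hx, comp_zero])
  have := he (n + 1 - N)
  obtain ⟨T₃, π₃, _, z'', hz''⟩ := surjective_up_to_refinements_of_epi (w.app (n + 1 - N)) y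
  let π : T₃ ⟶ T := π₃ ≫ π₂ ≫ π₁
  let σ : T ⟶ T₃ := Projective.factorThru (𝟙 T) π
  have hσ : σ ≫ π = 𝟙 T := Projective.factorThru_comp _ _
  refine ⟨σ ≫ (π₃ ≫ π₂ ≫ z - π₃ ≫ z' - z'' ≫ Z.dd (n + 1 - N) n), ?_, ?_⟩
  · rw [Category.assoc]
    have : (π₃ ≫ π₂ ≫ z - π₃ ≫ z' - z'' ≫ Z.dd (n + 1 - N) n) ≫ w.app n = 0 := by
      simp only [Preadditive.sub_comp, Category.assoc]
      rw [hy, ← dd_nat, ← Category.assoc z'', ← hz'']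
      simp
    rw [this, comp_zero]
  · rw [Category.assoc]
    have : (π₃ ≫ π₂ ≫ z - π₃ ≫ z' - z'' ≫ Z.dd (n + 1 - N) n) ≫ Z.d n = π ≫ x := by
      rw [dd_one] at hz hz'
      simp only [Preadditive.sub_comp, Category.assoc]
      rw [← hz, hz', dd_d _ _ _ (by omega), dd_zero _ _ _ (by omega)]
      simp [π]
    rw [this, ← Category.assoc, hσ, Category.id_comp]

lemma proj_lift (hN : 2 ≤ N) {P Z X : NComplex A N} (w : Z ⟶ X) (hw : qis A N w)
    (he : ∀ n, Epi (w.app n)) (hP : ∀ n, Projective (P.X n))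
    (hPb : ∃ m : ℤ, ∀ n > m, IsZero (P.X n)) (f : P ⟶ X) : ∃ g : P ⟶ Z, g ≫ w = f := by
  obtain ⟨m, hm⟩ := hPb
  obtain ⟨g, hg⟩ := desc_family (F := fun n => {g : P.X n ⟶ Z.X n // g ≫ w.app n = f.app n})
    (fun n g g' => g.1 ≫ Z.d n = P.d n ≫ g'.1) (m + 1)
    (fun n => ⟨Projective.factorThru (f.app n) (w.app n), Projective.factorThru_comp _ _⟩)
    (fun n hn => (hm n (by omega)).eq_of_src _ _) (by
      intro k g hg
      have hcomm : ∀ r : ℕ, (g (k + 1)).1 ≫ Z.dd (k + 1) (k + 1 + r) =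
          P.dd (k + 1) (k + 1 + r) ≫ (g (k + 1 + r)).1 := by
        intro r
        induction r with
        | zero =>
          have e : k + 1 + ((0 : ℕ) : ℤ) = k + 1 := by simp
          rw [e]; simp
        | succ r ih =>
          have e : k + 1 + ((r + 1 : ℕ) : ℤ) = k + 1 + r + 1 := by push_cast; ring
          rw [e, ← dd_d _ _ _ (by omega), ← dd_d _ _ _ (by omega), ← Category.assoc, ih,
            Category.assoc, hg _ (by omega), Category.assoc]
      let t : P.X k ⟶ Z.X k := Projective.factorThru (f.app k) (w.app k)
      have ht : t ≫ w.app k = f.app k := Projective.factorThru_comp _ _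
      obtain ⟨u, hu, hu'⟩ := proj_step hN w hw he k (t ≫ Z.d k - P.d k ≫ (g (k + 1)).1)
        (by
          rw [Preadditive.sub_comp, Category.assoc, Category.assoc, (g (k + 1)).2, ← w.comm,
            ← Category.assoc, ht, f.comm, sub_self])
        (by
          have e : k + (N : ℤ) = k + 1 + ((N - 1 : ℕ) : ℤ) := by omega
          rw [e, Preadditive.sub_comp, Category.assoc, Category.assoc, hcomm, ← dd_one, ← dd_one,
            dd_comp _ _ _ _ (by omega) (by omega), ← Category.assoc (P.dd _ _), dd_comp _ _ _ _ (by omega) (by omega),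
            dd_zero _ _ _ (by omega), dd_zero _ _ _ (by omega)]
          simp)
      refine ⟨⟨t - u, by rw [Preadditive.sub_comp, ht, hu, sub_zero]⟩, ?_⟩
      show (t - u) ≫ Z.d k = _
      rw [Preadditive.sub_comp, hu', sub_sub_cancel])
  refine ⟨⟨fun n => (g n).1, hg⟩, ?_⟩
  apply Hom.ext
  funext n
  exact (g n).2

lemma inj_step (hN : 2 ≤ N) {X Z : NComplex A N} (w : X ⟶ Z) (hw : qis A N w)
    (hmono : ∀ n, Mono (w.app n)) (n : ℤ) {T : A} [Injective T] (x : Z.X n ⟶ T)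
    (hx : w.app n ≫ x = 0) (hx' : Z.dd (n + 1 - N) n ≫ x = 0) :
    ∃ k : Z.X (n + 1) ⟶ T, w.app (n + 1) ≫ k = 0 ∧ Z.d n ≫ k = x := by
  have := hmono
  let δ : Z.X n ⟶ cokernel (w.app (n + 1)) := Z.d n ≫ cokernel.π _
  let S : ShortComplex A := ShortComplex.mk (kernel.ι δ) δ (kernel.condition δ)
  have hS : S.Exact := ShortComplex.exact_of_f_is_kernel _ (kernelIsKernel δ)
  have key : kernel.ι δ ≫ x = 0 := by
    let κ : kernel δ ⟶ Z.X n := kernel.ι δ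
    have hκ : (κ ≫ Z.d n) ≫ cokernel.π (w.app (n + 1)) = 0 := by
      rw [Category.assoc]; exact kernel.condition δ
    let y : kernel δ ⟶ X.X (n + 1) := Abelian.monoLift (w.app (n + 1)) (κ ≫ Z.d n) hκ
    have hy : y ≫ w.app (n + 1) = κ ≫ Z.d n := Abelian.monoLift_comp _ _ _
    obtain ⟨T₁, π₁, _, y', hy'⟩ := qis_inj hw n (n + 1) (n + N) (by omega) (by omega) rfl y
      (by
        rw [← cancel_mono (w.app _), Category.assoc, ← dd_nat, ← Category.assoc, hy, zero_comp,
          ← dd_one, Category.assoc, dd_comp _ _ _ _ (by omega) (by omega),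
          dd_zero _ _ _ (by omega), comp_zero])
      κ (by rw [hy, dd_one])
    obtain ⟨T₂, π₂, _, y'', hy'', z, hz⟩ := qis_surj hw (n + 1 - N) n (n + 1) (by omega)
      (by omega) (by omega) (π₁ ≫ κ - y' ≫ w.app n) (by
        rw [Preadditive.sub_comp, Category.assoc, Category.assoc, dd_nat, ← Category.assoc y',
          ← hy', dd_one, ← hy, Category.assoc, sub_self])
    have h1 : π₂ ≫ (π₁ ≫ κ - y' ≫ w.app n) ≫ x = 0 := by
      rw [← Category.assoc, hz, Preadditive.add_comp, Category.assoc, Category.assoc, hx, hx']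
      simp
    have h2 : π₁ ≫ κ ≫ x = 0 := by
      rw [← cancel_epi π₂, comp_zero, ← h1, Preadditive.sub_comp, Category.assoc, Category.assoc,
        hx, comp_zero, sub_zero]
    rw [← cancel_epi π₁, comp_zero]
    exact h2
  refine ⟨cokernel.π (w.app (n + 1)) ≫ hS.descToInjective x key, ?_, ?_⟩
  · rw [← Category.assoc, cokernel.condition, zero_comp]
  · rw [← Category.assoc]
    exact hS.comp_descToInjective x key

lemma inj_ext (hN : 2 ≤ N) {I X Z : NComplex A N} (w : X ⟶ Z) (hw : qis A N w)
    (hmono : ∀ n, Mono (w.app n)) (hI : ∀ n, Injective (I.X n))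
    (hIb : ∃ m : ℤ, ∀ n < m, IsZero (I.X n)) (f : X ⟶ I) : ∃ g : Z ⟶ I, w ≫ g = f := by
  obtain ⟨m, hm⟩ := hIb
  obtain ⟨g, hg⟩ := asc_family (F := fun n => {g : Z.X n ⟶ I.X n // w.app n ≫ g = f.app n})
    (fun n g g' => g.1 ≫ I.d n = Z.d n ≫ g'.1) (m - 1)
    (fun n => ⟨Injective.factorThru (f.app n) (w.app n), Injective.comp_factorThru _ _⟩)
    (fun n hn => (hm (n + 1) (by omega)).eq_of_tgt _ _) (by
      intro k g hg
      have hcomm : ∀ (r : ℕ) (p : ℤ), p + r = k → (g p).1 ≫ I.dd p k = Z.dd p k ≫ (g k).1 := by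
        intro r
        induction r with
        | zero =>
          intro p hp
          obtain rfl : p = k := by simpa using hp
          simp
        | succ r ih =>
          intro p hp
          push_cast at hp
          rw [← dd_comp I p (p + 1) k (by omega) (by omega),
            ← dd_comp Z p (p + 1) k (by omega) (by omega), dd_one, dd_one, ← Category.assoc,
            hg p (by omega), Category.assoc, ih (p + 1) (by omega), Category.assoc]
      let t : Z.X (k + 1) ⟶ I.X (k + 1) := Injective.factorThru (f.app (k + 1)) (w.app (k + 1))
      have ht : w.app (k + 1) ≫ t = f.app (k + 1) := Injective.comp_factorThru _ _
      obtain ⟨u, hu, hu'⟩ := inj_step hN w hw hmono k (Z.d k ≫ t - (g k).1 ≫ I.d k)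
        (by
          rw [Preadditive.comp_sub, ← Category.assoc, ← Category.assoc, (g k).2, w.comm,
            Category.assoc, ht, f.comm, sub_self])
        (by
          rw [Preadditive.comp_sub, ← Category.assoc, ← Category.assoc,
            ← hcomm (N - 1) (k + 1 - N) (by omega), Category.assoc (g _).1,
            dd_d _ _ _ (by omega), dd_d _ _ _ (by omega),
            dd_zero _ _ _ (by omega), dd_zero _ _ _ (by omega)]
          simp)
      refine ⟨⟨t - u, by rw [Preadditive.comp_sub, ht, hu, sub_zero]⟩, ?_⟩
      show _ = Z.d k ≫ (t - u)
      rw [Preadditive.comp_sub, hu', sub_sub_cancel])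
  refine ⟨⟨fun n => (g n).1, hg⟩, ?_⟩
  apply Hom.ext
  funext n
  exact (g n).2

lemma loc_lift (hN : 2 ≤ N) {P Z X : NComplex A N} (w : Z ⟶ X) (hw : qis A N w)
    (hP : ∀ n, Projective (P.X n))
    (hPb : ∃ m : ℤ, ∀ n > m, IsZero (P.X n)) (f : P ⟶ X) :
    ∃ g : P ⟶ Z, (qis A N).Q.map g ≫ (qis A N).Q.map w = (qis A N).Q.map f := by
  let C := cone X 0
  let w' : bi Z C ⟶ X := biDesc w (conePr X)
  have hfac : biInl Z C ≫ w' = w := biInl_desc _ _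
  have hw' : qis A N w' := qis_of_comp _ _ (biInl_qis Z X 0) (by rw [hfac]; exact hw)
  have he : ∀ n, Epi (w'.app n) := fun n => by
    have := conePr_epi (by omega) X n
    have h : (biInr Z C).app n ≫ w'.app n = (conePr X).app n := biprod.inr_desc _ _
    exact epi_of_epi_fac h
  obtain ⟨g, hg⟩ := proj_lift hN w' hw' he hP hPb f
  refine ⟨g ≫ biFst Z C, ?_⟩
  have hi := Localization.inverts (qis A N).Q (qis A N) _ (biFst_qis Z X 0)
  have h1 : (qis A N).Q.map (biFst Z C) ≫ (qis A N).Q.map (biInl Z C) = 𝟙 _ := by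
    rw [← cancel_mono ((qis A N).Q.map (biFst Z (cone X 0))), Category.assoc,
      ← Functor.map_comp, biInl_fst]
    simp [C]
  rw [← hg, ← hfac, Functor.map_comp, Functor.map_comp, Functor.map_comp, Category.assoc,
    ← Category.assoc ((qis A N).Q.map (biFst Z C)), h1, Category.id_comp]

lemma loc_ext (hN : 2 ≤ N) {I X Z : NComplex A N} (w : X ⟶ Z) (hw : qis A N w)
    (hI : ∀ n, Injective (I.X n))
    (hIb : ∃ m : ℤ, ∀ n < m, IsZero (I.X n)) (f : X ⟶ I) :
    ∃ g : Z ⟶ I, (qis A N).Q.map w ≫ (qis A N).Q.map g = (qis A N).Q.map f := by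
  let C := cone X (N - 1)
  let w' : X ⟶ bi Z C := biLift w (coneIn X)
  have hfac : w' ≫ biFst Z C = w := biLift_fst _ _
  have hw' : qis A N w' := qis_of_comp' _ _ (biFst_qis Z X (N - 1)) (by rw [hfac]; exact hw)
  have he : ∀ n, Mono (w'.app n) := fun n => by
    have := coneIn_mono (by omega) X n
    have h : w'.app n ≫ (biSnd Z C).app n = (coneIn X).app n := biprod.lift_snd _ _
    exact mono_of_mono_fac h
  obtain ⟨g, hg⟩ := inj_ext hN w' hw' he hI hIb f
  refine ⟨biInl Z C ≫ g, ?_⟩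
  have hi := Localization.inverts (qis A N).Q (qis A N) _ (biFst_qis Z X (N - 1))
  have h1 : (qis A N).Q.map (biFst Z C) ≫ (qis A N).Q.map (biInl Z C) = 𝟙 _ := by
    rw [← cancel_mono ((qis A N).Q.map (biFst Z (cone X (N - 1)))), Category.assoc,
      ← Functor.map_comp, biInl_fst]
    simp [C]
  rw [← hg, ← hfac, Functor.map_comp, Functor.map_comp, Functor.map_comp, Category.assoc,
    ← Category.assoc ((qis A N).Q.map (biFst Z C)), h1, Category.id_comp]

end NComplex

/-- Let `A` be an abelian category, `X•` an `N`-complex, `P•` a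
bounded-above `N`-complex of projectives and `I•` a bounded-below `N`-complex of
injectives.  In the derived category `D_N(A)` (the localization of `N`-complexes at the
quasi-isomorphisms), every morphism `P• → X•` is represented by an actual morphism of
`N`-complexes, and likewise every morphism `X• → I•`. -/
theorem morphisms_from_projectives_to_injectives_represented
    {A : Type u} [Category.{v} A] [Abelian A] (N : ℕ) (hN : 2 ≤ N)
    (P X I : NComplex A N)
    (hP : ∀ n, Projective (P.X n)) (hPb : ∃ m : ℤ, ∀ n > m, IsZero (P.X n))
    (hI : ∀ n, Injective (I.X n)) (hIb : ∃ m : ℤ, ∀ n < m, IsZero (I.X n)) :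
    (∀ φ : (NComplex.qis A N).Q.obj P ⟶ (NComplex.qis A N).Q.obj X,
      ∃ f : P ⟶ X, (NComplex.qis A N).Q.map f = φ) ∧
    (∀ ψ : (NComplex.qis A N).Q.obj X ⟶ (NComplex.qis A N).Q.obj I,
      ∃ g : X ⟶ I, (NComplex.qis A N).Q.map g = ψ) := by
  exact ⟨rep_left _ P (fun _ _ w hw f => NComplex.loc_lift hN w hw hP hPb f) X,
    rep_right _ I (fun _ _ w hw f => NComplex.loc_ext hN w hw hI hIb f) X⟩
end
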